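/- Fix an integer k ≥ 3 and set α_k = e·k^{−k/(k−2)}. (i) For every c ∈ (2/k, 1] and every α ∈ (0, α_k), taking ζ₁ = (ck)^{−1/2} α^{1/2} and ζ₂ = 1 − α gives H_k(α, (ζ₁,ζ₂); c) ≤ cα(k/2 − 1) ln(α/α_k); moreover ζ₂ ≥ 1 − α_k > 0. (ii) For every δ ∈ (0, 0.99·α_k] there exists ε > 0 (depending only on k and δ) such that for all c ∈ (2/k, 1] and all α ∈ [δ, 0.99·α_k], with the same choice of ζ, H_k(α, (ζ₁,ζ₂); c) ≤ −ε. -/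

import Mathlib

/-- `f(x) = e^x - 1 - x`. -/
noncomputable def fEx (x : ℝ) : ℝ := Real.exp x - 1 - x

/-- `ψ(x) = x (e^x - 1) / (e^x - 1 - x)` for `x ≠ 0`, extended by `ψ(0) = 2`. -/
noncomputable def psi (x : ℝ) : ℝ :=
  if x = 0 then 2 else x * (Real.exp x - 1) / (Real.exp x - 1 - x)

/-- The entropy function `H(α) = -α ln α - (1-α) ln(1-α)`. -/
noncomputable def Hent (a : ℝ) : ℝ := -(a * Real.log a) - (1 - a) * Real.log (1 - a)

/-- `H_k(α, (ζ₁,ζ₂); c)` with `λ` the positive root of `ψ(λ) = ck` passed explicitly. -/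
noncomputable def HkF (k : ℕ) (a z1 z2 c lam : ℝ) : ℝ :=
  c * Hent a + c * k * a * Real.log (a / z1) + c * k * (1 - a) * Real.log ((1 - a) / z2)
    + Real.log ((fEx (lam * (z2 + z1)) + fEx (lam * (z2 - z1))) / (2 * fEx lam))

/-- `α_k = e k^{-k/(k-2)}`. -/
noncomputable def alphaK (k : ℕ) : ℝ :=
  Real.exp 1 * (k : ℝ) ^ (-(k : ℝ) / ((k : ℝ) - 2))

lemma fEx_pos {x : ℝ} (hx : 0 < x) : 0 < fEx x := by
  have := Real.add_one_lt_exp hx.ne'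
  unfold fEx; linarith

/-- cross-multiplied monotonicity of `(e^x-1)/x`. -/
lemma slope_aux {x y : ℝ} (hx : 0 < x) (hxy : x < y) :
    y * (Real.exp x - 1) ≤ x * (Real.exp y - 1) := by
  have q1 : 0 ≤ 1 - x / y := by
    rw [sub_nonneg, div_le_one (by linarith)]; exact hxy.le
  have q2 : 0 ≤ x / y := div_nonneg hx.le (by linarith)
  have h := convexOn_exp.2 (Set.mem_univ (0:ℝ)) (Set.mem_univ y) q1 q2 (by ring)
  have hy : 0 < y := by linarith
  simp only [smul_eq_mul, mul_zero, zero_add, Real.exp_zero, mul_one] at h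
  rw [div_mul_cancel₀ _ hy.ne'] at h
  have e : y * (1 - x / y + x / y * Real.exp y) = y - x + x * Real.exp y := by
    field_simp
  have := mul_le_mul_of_nonneg_left h hy.le
  rw [e] at this
  linarith

lemma ratio_anti {x y : ℝ} (hx : 0 < x) (hxy : x < y) :
    (Real.exp y - 1) / fEx y ≤ (Real.exp x - 1) / fEx x := by
  rw [div_le_div_iff₀ (fEx_pos (hx.trans hxy)) (fEx_pos hx)]
  have := slope_aux hx hxy
  unfold fEx
  nlinarith

lemma hasDeriv_logf {x : ℝ} (hx : 0 < x) :
    HasDerivAt (fun t => Real.log (fEx t)) ((Real.exp x - 1) / fEx x) x := by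
  have h : HasDerivAt fEx (Real.exp x - 1) x := by
    have := ((Real.hasDerivAt_exp x).sub_const 1).sub (hasDerivAt_id x)
    exact this
  exact h.log (fEx_pos hx).ne'

lemma tangent {l x : ℝ} (hl : 0 < l) (hx : 0 < x) :
    Real.log (fEx x) ≤ Real.log (fEx l) + (Real.exp l - 1) / fEx l * (x - l) := by
  rcases lt_trichotomy x l with h | h | h
  · obtain ⟨t, ht, he⟩ := exists_hasDerivAt_eq_slope (fun t => Real.log (fEx t))
      (fun t => (Real.exp t - 1) / fEx t) h
      (fun t ht => (hasDeriv_logf (hx.trans_le ht.1)).continuousAt.continuousWithinAt)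
      (fun t ht => hasDeriv_logf (hx.trans ht.1))
    rw [eq_div_iff (by linarith)] at he
    have := ratio_anti (hx.trans ht.1) ht.2
    nlinarith [mul_le_mul_of_nonneg_right this (sub_nonneg.2 h.le)]
  · subst h; simp
  · obtain ⟨t, ht, he⟩ := exists_hasDerivAt_eq_slope (fun t => Real.log (fEx t))
      (fun t => (Real.exp t - 1) / fEx t) h
      (fun t ht => (hasDeriv_logf (hl.trans_le ht.1)).continuousAt.continuousWithinAt)
      (fun t ht => hasDeriv_logf (hl.trans ht.1))
    rw [eq_div_iff (by linarith)] at he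
    have := ratio_anti hl ht.1
    nlinarith [mul_le_mul_of_nonneg_right this (sub_nonneg.2 h.le)]

lemma fEx_le {l z : ℝ} (hl : 0 < l) (hz : 0 < z) :
    fEx (l * z) ≤ fEx l * Real.exp (psi l * (z - 1)) := by
  have hp : psi l = l * ((Real.exp l - 1) / fEx l) := by
    unfold psi fEx; rw [if_neg hl.ne']; ring
  have h := tangent hl (mul_pos hl hz)
  have h2 := Real.exp_le_exp.2 h
  rw [Real.exp_add, Real.exp_log (fEx_pos (mul_pos hl hz)), Real.exp_log (fEx_pos hl)] at h2
  rw [hp]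
  convert h2 using 3
  ring

lemma alphaK_pos (k : ℕ) (hk : 3 ≤ k) : 0 < alphaK k := by
  unfold alphaK
  have : (0:ℝ) < k := by positivity
  positivity

lemma alphaK_half (k : ℕ) (hk : 3 ≤ k) : alphaK k ≤ 1 / 2 := by
  have hk' : (3:ℝ) ≤ k := by exact_mod_cast hk
  have key : (6:ℝ) ≤ (k:ℝ) ^ ((k : ℝ) / ((k : ℝ) - 2)) := by
    rcases le_or_gt 6 k with h | h
    · have h' : (6:ℝ) ≤ k := by exact_mod_cast h
      have : (k:ℝ) ^ (1:ℝ) ≤ (k:ℝ) ^ ((k : ℝ) / ((k : ℝ) - 2)) := by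
        apply Real.rpow_le_rpow_of_exponent_le (by linarith)
        rw [le_div_iff₀ (by linarith)]; linarith
      rw [Real.rpow_one] at this
      linarith
    · have h' : (k:ℝ) ≤ 5 := by exact_mod_cast (by omega : k ≤ 5)
      have h1 : (k:ℝ) ^ (5/3:ℝ) ≤ (k:ℝ) ^ ((k : ℝ) / ((k : ℝ) - 2)) := by
        apply Real.rpow_le_rpow_of_exponent_le (by linarith)
        rw [le_div_iff₀ (by linarith)]; linarith
      have h2 : (3:ℝ) ^ (5/3:ℝ) ≤ (k:ℝ) ^ (5/3:ℝ) :=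
        Real.rpow_le_rpow (by norm_num) hk' (by norm_num)
      have h3 : (6:ℝ) ≤ (3:ℝ) ^ (5/3:ℝ) := by
        have e : ((3:ℝ) ^ (5/3:ℝ)) ^ 3 = 243 := by
          rw [← Real.rpow_natCast, ← Real.rpow_mul (by norm_num)]
          norm_num
        by_contra hc
        push Not at hc
        have := pow_lt_pow_left₀ hc (by positivity) (n := 3) (by norm_num)
        rw [e] at this
        norm_num at this
      linarith
  unfold alphaK
  rw [neg_div, Real.rpow_neg (by linarith), ← div_eq_mul_inv, div_le_div_iff₀ (by linarith) (by norm_num)]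
  have := Real.exp_one_lt_d9
  linarith

lemma log_alphaK (k : ℕ) (hk : 3 ≤ k) :
    ((k:ℝ) / 2 - 1) * Real.log (alphaK k) = ((k:ℝ) / 2 - 1) - k / 2 * Real.log k := by
  have hk' : (3:ℝ) ≤ k := by exact_mod_cast hk
  have h0 : (0:ℝ) < k := by linarith
  have h2 : (k:ℝ) - 2 ≠ 0 := by linarith
  unfold alphaK
  rw [Real.log_mul (Real.exp_pos _).ne' (Real.rpow_pos_of_pos h0 _).ne', Real.log_exp,
    Real.log_rpow h0]
  field_simp
  ring

lemma part1 (k : ℕ) (hk : 3 ≤ k) (c : ℝ) (hc : 2 / k < c) (hc1 : c ≤ 1) (a : ℝ) (ha : 0 < a)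
    (hak : a < alphaK k) (lam : ℝ) (hl : 0 < lam) (hpsi : psi lam = c * k) :
    HkF k a (Real.sqrt a / Real.sqrt (c * k)) (1 - a) c lam
            ≤ c * a * ((k : ℝ) / 2 - 1) * Real.log (a / alphaK k) := by
  have hk' : (3:ℝ) ≤ k := by exact_mod_cast hk
  have h0 : (0:ℝ) < k := by linarith
  have hc0 : 0 < c := lt_trans (by positivity) hc
  have hck : 2 < c * k := by rwa [div_lt_iff₀ h0] at hc
  have hA := alphaK_half k hk
  have hA0 := alphaK_pos k hk
  have ha2 : a < 1 / 2 := by linarith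
  set z : ℝ := Real.sqrt a / Real.sqrt (c * k) with hz
  have hz0 : 0 < z := by
    have : 0 < c * k := by linarith
    positivity
  have hzsq : z ^ 2 * (c * k) = a := by
    rw [hz, div_pow, Real.sq_sqrt ha.le, Real.sq_sqrt (by linarith)]
    field_simp
  have hz1 : z < 1 - a := by
    have : z ^ 2 < (1 - a) ^ 2 := by nlinarith [sq_nonneg z]
    exact lt_of_pow_lt_pow_left₀ 2 (by linarith) this
  -- the last logarithm
  have hL : Real.log ((fEx (lam * (1 - a + z)) + fEx (lam * (1 - a - z))) / (2 * fEx lam))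
      ≤ - (c * k * a) / 2 := by
    have hf := fEx_pos hl
    have p1 := fEx_pos (mul_pos hl (by linarith : 0 < 1 - a + z))
    have p2 := fEx_pos (mul_pos hl (by linarith : 0 < 1 - a - z))
    have b1 := fEx_le hl (by linarith : 0 < 1 - a + z)
    have b2 := fEx_le hl (by linarith : 0 < 1 - a - z)
    rw [hpsi] at b1 b2
    rw [Real.log_le_iff_le_exp (by positivity), div_le_iff₀ (by positivity)]
    have e1 : c * k * (1 - a + z - 1) = -(c * k * a) + c * k * z := by ring
    have e2 : c * k * (1 - a - z - 1) = -(c * k * a) + -(c * k * z) := by ring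
    rw [e1, Real.exp_add] at b1
    rw [e2, Real.exp_add] at b2
    have hcosh := Real.cosh_le_exp_half_sq (c * k * z)
    rw [Real.cosh_eq] at hcosh
    have e3 : (c * k * z) ^ 2 / 2 = c * k * a / 2 := by
      rw [← hzsq]; ring
    rw [e3] at hcosh
    have e4 : Real.exp (-(c * k * a) / 2) = Real.exp (-(c * k * a)) * Real.exp (c * k * a / 2) := by
      rw [← Real.exp_add]; congr 1; ring
    rw [e4]
    have := mul_le_mul_of_nonneg_left hcosh
      (mul_pos hf (Real.exp_pos (-(c * k * a)))).le
    nlinarith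
  have hlogz : Real.log (a / z) = (Real.log a + Real.log c + Real.log k) / 2 := by
    rw [hz, Real.log_div ha.ne' (by positivity), Real.log_div (by positivity) (by positivity),
      Real.log_sqrt ha.le, Real.log_sqrt (by positivity), Real.log_mul hc0.ne' h0.ne']
    ring
  have hone : -((1 - a) * Real.log (1 - a)) ≤ a := by
    have := Real.one_sub_inv_le_log_of_pos (by linarith : 0 < 1 - a)
    have h := mul_le_mul_of_nonneg_left this (by linarith : 0 ≤ 1 - a)
    rw [mul_sub, mul_inv_cancel₀ (by linarith)] at h
    linarith
  have hlc : Real.log c ≤ 0 := Real.log_nonpos hc0.le hc1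
  have hla := log_alphaK k hk
  unfold HkF Hent
  rw [div_self (by linarith : (1 - a) ≠ 0), Real.log_one, hlogz, Real.log_div ha.ne' hA0.ne']
  have e5 : c * a * ((k:ℝ) / 2 - 1) * (Real.log a - Real.log (alphaK k))
      = c * a * (((k:ℝ) / 2 - 1) * Real.log a - ((k:ℝ) / 2 - 1) + k / 2 * Real.log k) := by
    linear_combination (- (c * a)) * hla
  rw [e5]
  have i1 := mul_le_mul_of_nonneg_left hone hc0.le
  have i2 := mul_nonneg_of_nonpos_of_nonpos hlc (by
    have : 0 < c * k * a := by positivity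
    linarith : -(c * k * a) ≤ 0)
  linarith

theorem Hk_small_alpha (k : ℕ) (hk : 3 ≤ k) :
    ((1 : ℝ) - alphaK k > 0 ∧
      ∀ c : ℝ, 2 / k < c → c ≤ 1 →
      ∀ a : ℝ, 0 < a → a < alphaK k →
      ∀ lam : ℝ, 0 < lam → psi lam = c * k →
        HkF k a (Real.sqrt a / Real.sqrt (c * k)) (1 - a) c lam
            ≤ c * a * ((k : ℝ) / 2 - 1) * Real.log (a / alphaK k) ∧
          (1 : ℝ) - a ≥ 1 - alphaK k) ∧
    (∀ δ : ℝ, 0 < δ → δ ≤ 0.99 * alphaK k →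
      ∃ ε : ℝ, 0 < ε ∧
        ∀ c : ℝ, 2 / k < c → c ≤ 1 →
        ∀ a : ℝ, δ ≤ a → a ≤ 0.99 * alphaK k →
        ∀ lam : ℝ, 0 < lam → psi lam = c * k →
          HkF k a (Real.sqrt a / Real.sqrt (c * k)) (1 - a) c lam ≤ -ε) := by
  have h2 := alphaK_half k hk
  have h1 := alphaK_pos k hk
  refine ⟨⟨by linarith, fun c hc hc1 a ha hak lam hl hp =>
    ⟨part1 k hk c hc hc1 a ha hak lam hl hp, by linarith⟩⟩, ?_⟩
  intro δ hδ _
  have hk' : (3:ℝ) ≤ k := by exact_mod_cast hk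
  have h0 : (0:ℝ) < k := by linarith
  have hlog : Real.log 0.99 < 0 := Real.log_neg (by norm_num) (by norm_num)
  have hk2 : (0:ℝ) < k / 2 - 1 := by linarith
  refine ⟨2 / k * δ * ((k:ℝ) / 2 - 1) * (-Real.log 0.99),
    mul_pos (by positivity) (by linarith), ?_⟩
  intro c hc hc1 a hda ha lam hl hp
  have ha0 : 0 < a := by linarith
  refine (part1 k hk c hc hc1 a ha0 (by linarith) lam hl hp).trans ?_
  have hlog2 : Real.log (a / alphaK k) ≤ Real.log 0.99 := by
    apply Real.log_le_log (by positivity)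
    rwa [div_le_iff₀ h1]
  have hc0 : 0 < c := lt_trans (by positivity) hc
  have hm : 2 / k * δ * ((k:ℝ) / 2 - 1) ≤ c * a * ((k:ℝ) / 2 - 1) := by
    gcongr
  have hp2 : 0 ≤ c * a * ((k:ℝ) / 2 - 1) := by positivity
  have j1 := mul_le_mul_of_nonneg_left hlog2 hp2
  have j2 := mul_le_mul_of_nonneg_right hm (by linarith : 0 ≤ -Real.log 0.99)
  linarith
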